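/- arXiv:0706.2118 — 3 statements merged into one kernel-verified Lean document; each statement's English description precedes it below -/
import Mathlib

section
/- Let F : 𝒫 → Ab be an n-condensed functor on a graded poset 𝒫. Then the natural transformation λ : F ⇒ Ker'_F is a monomorphism, so there is a short exact sequence 0 → F → Ker'_F → G → 0 in Ab^𝒫, where G takes the value G(p₀) = (∏_{p ∈ (p₀↓𝒫)_n} F(p)) / λ_{p₀}(F(p₀)) on each object p₀. -/
open Finset

/-- A graded poset (with the standing assumptions of Remark 2.5: the degree function is
order-reversing, adds one along preceding pairs, takes nonnegative values, and every
up-set is finite). -/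
structure GradedPoset (P : Type) [PartialOrder P] : Type where
  deg : P → ℤ
  deg_antitone : ∀ ⦃p q : P⦄, p ≤ q → deg q ≤ deg p
  deg_step : ∀ ⦃p q : P⦄, p < q → (∀ r, p ≤ r → r ≤ q → r = p ∨ r = q) → deg p = deg q + 1
  deg_nonneg : ∀ p, 0 ≤ deg p
  finite_up : ∀ p : P, {q : P | p ≤ q}.Finite

/-- A functor from a poset `P` to the category `Ab` of abelian groups. -/
structure PosetFunctor (P : Type) [PartialOrder P] : Type 1 where
  obj : P → Type
  grp : ∀ p, AddCommGroup (obj p)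
  map : ∀ {p q : P}, p ≤ q → obj p →+ obj q
  map_id : ∀ (p : P) (x : obj p), map (le_refl p) x = x
  map_comp : ∀ {p q r : P} (h₁ : p ≤ q) (h₂ : q ≤ r) (x : obj p),
    map h₂ (map h₁ x) = map (h₁.trans h₂) x

attribute [instance] PosetFunctor.grp

variable {P : Type} [PartialOrder P]

/-- A natural transformation between functors `P → Ab`. -/
structure PosetHom (F G : PosetFunctor P) : Type where
  app : ∀ p : P, F.obj p →+ G.obj p
  naturality : ∀ {p q : P} (h : p ≤ q) (x : F.obj p),
    G.map h (app p x) = app q (F.map h x)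

/-- The constant functor with value `ℤ`. -/
def constZ (P : Type) [PartialOrder P] : PosetFunctor P where
  obj _ := ℤ
  grp _ := inferInstance
  map _ := AddMonoidHom.id ℤ
  map_id _ _ := rfl
  map_comp _ _ _ := rfl

namespace PosetFunctor

/-- The inverse limit `lim F` of `F : P → Ab`, realized as the group of compatible
families (sections). -/
def sections (F : PosetFunctor P) : AddSubgroup (∀ p, F.obj p) where
  carrier := {x | ∀ (p q : P) (h : p ≤ q), F.map h (x p) = x q}
  zero_mem' := by intro p q h; simp
  add_mem' := by intro a b ha hb p q h; simp [map_add, ha p q h, hb p q h]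
  neg_mem' := by intro a ha p q h; simp [ha p q h]

/-- The functor `F'` with `F'(p₀) = ∏_{p₀ ≤ p} F(p)`; a morphism `p₁ ≤ p₀` acts by
sending the factor indexed by `p₁ ≤ p` identically to the factor indexed by `p₀ ≤ p`
when `p₀ ≤ p`, and by zero otherwise. -/
def prime (F : PosetFunctor P) : PosetFunctor P where
  obj p₀ := ∀ q : {q : P // p₀ ≤ q}, F.obj q.1
  grp _ := inferInstance
  map h := AddMonoidHom.mk' (fun x q => x ⟨q.1, h.trans q.2⟩) (fun _ _ => rfl)
  map_id _ _ := rfl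
  map_comp _ _ _ := rfl

end PosetFunctor

/-- The subgroup `Ker_F(p₀) = ⋂_{p₀ < q} Ker (F(p₀ → q))`. -/
def kerAt (F : PosetFunctor P) (p₀ : P) : AddSubgroup (F.obj p₀) where
  carrier := {x | ∀ (q : P) (h : p₀ < q), F.map h.le x = 0}
  zero_mem' := by intro q h; simp
  add_mem' := by intro a b ha hb q h; simp [map_add, ha q h, hb q h]
  neg_mem' := by intro a ha q h; simp [ha q h]

/-- `F` is `n`-condensed: `F(p) = 0` for `deg p < n` and `Ker_F(p) = 0` for `deg p > n`. -/
def IsCondensed (G : GradedPoset P) (F : PosetFunctor P) (n : ℕ) : Prop :=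
  (∀ p : P, G.deg p < (n : ℤ) → ∀ x : F.obj p, x = 0) ∧
  (∀ p : P, (n : ℤ) < G.deg p → ∀ x ∈ kerAt F p, x = 0)

/-- The set `(p₀ ↓ P)_n` of objects above `p₀` of degree `n`. -/
def degSet (G : GradedPoset P) (p₀ : P) (n : ℕ) : Set P :=
  {q : P | p₀ ≤ q ∧ G.deg q = (n : ℤ)}

/-- The functor `Ker'_F` (for an `n`-condensed functor `F`):
`Ker'_F(p₀) = ∏_{p ∈ (p₀↓P)_n} F(p)`. -/
def kerPrime (G : GradedPoset P) (F : PosetFunctor P) (n : ℕ) : PosetFunctor P where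
  obj p₀ := ∀ q : degSet G p₀ n, F.obj q.1
  grp _ := inferInstance
  map h := AddMonoidHom.mk' (fun x q => x ⟨q.1, h.trans q.2.1, q.2.2⟩) (fun _ _ => rfl)
  map_id _ _ := rfl
  map_comp _ _ _ := rfl

/-- The natural transformation `λ : F ⇒ Ker'_F` with components
`λ_{p₀} = ∏_{p ∈ (p₀↓P)_n} F(p₀ → p)`. -/
def lambdaNT (G : GradedPoset P) (F : PosetFunctor P) (n : ℕ) :
    PosetHom F (kerPrime G F n) where
  app p₀ := AddMonoidHom.mk' (fun x q => F.map q.2.1 x)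
    (by intro a b; funext q; exact map_add _ a b)
  naturality := by
    intro p q h x
    funext r
    exact (F.map_comp h r.2.1 x).symm

/-! ### The cochain complex computing higher inverse limits -/

/-- Composable chains `p₀ ≤ p₁ ≤ … ≤ pₙ` in `P`. -/
def ChainP (P : Type) [PartialOrder P] (n : ℕ) : Type :=
  {c : Fin (n + 1) → P // Monotone c}

/-- `n`-cochains of the cobar complex computing the derived functors of `lim` over `P`
with coefficients in `F`. -/
abbrev cochain (F : PosetFunctor P) (n : ℕ) : Type :=
  ∀ c : ChainP P n, F.obj (c.1 (Fin.last n))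

/-- The `i`-th face of a chain. -/
def chainFace {n : ℕ} (i : Fin (n + 2)) (c : ChainP P (n + 1)) : ChainP P n :=
  ⟨c.1 ∘ i.succAbove, c.2.comp (Fin.strictMono_succAbove i).monotone⟩

/-- The differential of the cobar complex. -/
noncomputable def cobarDiff (F : PosetFunctor P) (n : ℕ) : cochain F n →+ cochain F (n + 1) :=
  AddMonoidHom.mk'
    (fun ψ c => ∑ i : Fin (n + 2),
      ((-1 : ℤ) ^ (i : ℕ)) • F.map (c.2 (Fin.le_last (i.succAbove (Fin.last n))))
        (ψ (chainFace i c)))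
    (by
      intro a b; funext c
      simp only [Pi.add_apply, map_add, smul_add]
      refine Eq.trans (Finset.sum_congr rfl fun i _ => ?_) Finset.sum_add_distrib
      exact (congrArg (fun y => ((-1 : ℤ) ^ (i : ℕ)) • y)
        (map_add (F.map (c.2 (Fin.le_last (i.succAbove (Fin.last n)))))
          (a (chainFace i c)) (b (chainFace i c)))).trans (smul_add _ _ _))

/-- Coboundaries of the cobar complex. -/
noncomputable def cobarCoboundaries (F : PosetFunctor P) : ∀ n : ℕ, AddSubgroup (cochain F n)
  | 0 => ⊥
  | n + 1 => (cobarDiff F n).range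

/-- `H^n(P; F) = lim^n F`, the cohomology of `P` with coefficients in `F`, computed by
the cobar complex. -/
noncomputable def cohomologyOf (F : PosetFunctor P) (n : ℕ) : Type :=
  (cobarDiff F n).ker ⧸ ((cobarCoboundaries F n).addSubgroupOf (cobarDiff F n).ker)

noncomputable instance (F : PosetFunctor P) (n : ℕ) : AddCommGroup (cohomologyOf F n) :=
  inferInstanceAs (AddCommGroup (_ ⧸ _))

/-- The `n`-th Betti number of `P` with coefficients in `F`: the rank of `H^n(P;F)`. -/
noncomputable def bettiOf (F : PosetFunctor P) (n : ℕ) : ℕ :=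
  Module.finrank ℤ (cohomologyOf F n)

/-! ### Free functors, pure maps, local covering families -/

/-- A functor is free if all its values are finitely generated free abelian groups. -/
def IsFreeFunctor (F : PosetFunctor P) : Prop :=
  ∀ p : P, Module.Free ℤ (F.obj p) ∧ Module.Finite ℤ (F.obj p)

/-- A map of abelian groups is pure if its cokernel is a free abelian group. -/
def IsPureHom {A B : Type} [AddCommGroup A] [AddCommGroup B] (f : A →+ B) : Prop :=
  Module.Free ℤ (B ⧸ f.range)

/-- Sections of `F` over a subset `S ⊆ P`, i.e. `lim_S F`. -/
def sectionsOnSet (F : PosetFunctor P) (S : Set P) : Set (∀ q : S, F.obj q.1) :=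
  {x | ∀ (q r : S) (h : q.1 ≤ r.1), F.map h (x q) = x r}

/-- The restriction map `lim_{(p₀↓P)_*} F → ∏_{q ∈ S} F(q)` (for `S` a set of objects
strictly above `p₀`, realized by intersecting with `{q | p₀ < q}`). -/
def limRestriction (F : PosetFunctor P) (p₀ : P) (S : Set P) :
    ↥(sectionsOnSet F {q : P | p₀ < q}) → ∀ q : ↥(S ∩ {q : P | p₀ < q}), F.obj q.1 :=
  fun x q => x.1 ⟨q.1, q.2.2⟩

/-- The map `F(p₀) → ∏_{q ∈ S} F(q)` (for `S` a set of objects above `p₀`, realized by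
intersecting with `{q | p₀ ≤ q}`). -/
def detMap (F : PosetFunctor P) (p₀ : P) (S : Set P) :
    F.obj p₀ →+ ∀ q : ↥(S ∩ {q : P | p₀ ≤ q}), F.obj q.1 :=
  AddMonoidHom.mk' (fun x q => F.map q.2.2 x) (by intro a b; funext q; exact map_add _ a b)

/-- A local covering family `𝒥 = {J_n^{p₀}}` (Definition 3.4). -/
def IsLCF (G : GradedPoset P) (J : P → ℕ → Set P) : Prop :=
  (∀ (p : P) (m : ℕ), J p m ⊆ degSet G p m) ∧
  (∀ (p : P) (m : ℕ), (m : ℤ) < G.deg p →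
    (⋃ r ∈ J p (m + 1), degSet G r m) = degSet G p m) ∧
  (∀ (p : P) (m : ℕ), ∀ r ∈ J p (m + 1), J r m ⊆ J p m)

/-- `F` (an `n`-condensed free functor) is `𝒥`-determined (Definition 3.5). -/
def IsDetermined (G : GradedPoset P) (J : P → ℕ → Set P) (F : PosetFunctor P) (n : ℕ) :
    Prop :=
  (∀ p₀ : P, (n : ℤ) + 1 < G.deg p₀ →
    Function.Injective (limRestriction F p₀ (J p₀ n)) ∧ IsPureHom (detMap F p₀ (J p₀ n))) ∧
  (∀ p₀ : P, G.deg p₀ = (n : ℤ) + 1 →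
    IsPureHom (detMap F p₀ (J p₀ n)) ∧ Function.Injective (detMap F p₀ (J p₀ n)))

/-- The finite set `(p↓P)_n`. -/
noncomputable def degFinset (G : GradedPoset P) (p : P) (n : ℕ) : Finset P :=
  ((G.finite_up p).subset
    (show degSet G p n ⊆ {q : P | p ≤ q} from fun _ hq => hq.1)).toFinset

/-- The numbers `R_n^{p₀}` (Definition 4.1). -/
noncomputable def Rnum (G : GradedPoset P) : ℕ → P → ℤ
  | 0, _ => 1
  | m + 1, p => (∑ q ∈ degFinset G p m, Rnum G m q) - Rnum G m p

/-- The finite set `J_n^p` (as a `Finset`, using finiteness of up-sets). -/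
noncomputable def JFinset (G : GradedPoset P) (J : P → ℕ → Set P) (p : P) (n : ℕ) :
    Finset P :=
  ((G.finite_up p).inter_of_left (J p n)).toFinset

/-- Connectedness of a subset of a poset, viewed as a full subcategory. -/
def IsConnectedSet (S : Set P) : Prop :=
  S.Nonempty ∧ ∀ a b : S, Relation.ReflTransGen (fun x y : S => x.1 ≤ y.1 ∨ y.1 ≤ x.1) a b

/-- An adequate local covering family (Definition 4.2). -/
def IsAdequate (G : GradedPoset P) (J : P → ℕ → Set P) : Prop :=
  IsLCF G J ∧
  (∀ p : P, 2 ≤ G.deg p → IsConnectedSet {q : P | p < q}) ∧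
  (∀ (m : ℕ) (p : P), (m : ℤ) + 1 ≤ G.deg p →
    Rnum G m p = ∑ q ∈ JFinset G J p m, Rnum G m q)

/-! ### The global complex and global covering families -/

/-- Restriction of a product of abelian groups to a subset of the index set. -/
def restrictTo {ι : Type} {A : ι → Type} [∀ i, AddCommGroup (A i)] (S : Set ι) :
    (∀ i, A i) →+ ∀ i : S, A i.1 :=
  AddMonoidHom.mk' (fun x i => x i.1) (fun _ _ => rfl)

open Classical in
/-- Extension by zero of a family indexed by a subset of the index set. -/
noncomputable def extendZero {ι : Type} {A : ι → Type} [∀ i, AddCommGroup (A i)]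
    (S : Set ι) : (∀ i : S, A i.1) →+ ∀ i, A i :=
  AddMonoidHom.mk' (fun x i => if h : i ∈ S then x ⟨i, h⟩ else 0)
    (by intro a b; funext i; by_cases h : i ∈ S <;> simp [h])

/-- The map on full products induced by a natural transformation
`π : Ker'_F ⇒ F'` (the building block of the differential `d = ι ∘ ω`). -/
noncomputable def dhat (G : GradedPoset P) {F F' : PosetFunctor P} (n : ℕ)
    (π : PosetHom (kerPrime G F n) F') : (∀ p : P, F.obj p) →+ ∀ p : P, F'.obj p :=
  AddMonoidHom.mk' (fun x p => π.app p (fun q => x q.1))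
    (by intro a b; funext p; exact map_add (π.app p) _ _)

/-- The set `Ob_n(P)` of objects of degree `n`. -/
def obSet (G : GradedPoset P) (n : ℕ) : Set P := {p : P | G.deg p = (n : ℤ)}

/-- The differential `d_n = ι_{n+1} ∘ ω_{n+1} : ∏_{Ob_n} F_n(p) → ∏_{Ob_{n+1}} F_{n+1}(p)`. -/
noncomputable def obDiff (G : GradedPoset P) (F : ℕ → PosetFunctor P)
    (π : ∀ n : ℕ, PosetHom (kerPrime G (F n) n) (F (n + 1))) (n : ℕ) :
    (∀ p : ↥(obSet G n), (F n).obj p.1) →+ ∀ p : ↥(obSet G (n + 1)), (F (n + 1)).obj p.1 :=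
  (restrictTo (obSet G (n + 1))).comp ((dhat G n (π n)).comp (extendZero (obSet G n)))

/-- The composite `∏_{p ∈ Ob_n(P)∖K_n} F_n(p) → ∏_{p ∈ K_{n+1}} F_{n+1}(p)`
induced by the differential. -/
noncomputable def wMap (G : GradedPoset P) (F : ℕ → PosetFunctor P)
    (π : ∀ n : ℕ, PosetHom (kerPrime G (F n) n) (F (n + 1))) (K : ℕ → Set P) (n : ℕ) :
    (∀ p : ↥(obSet G n \ K n), (F n).obj p.1) →+ ∀ p : ↥(K (n + 1)), (F (n + 1)).obj p.1 :=
  (restrictTo (K (n + 1))).comp ((dhat G n (π n)).comp (extendZero (obSet G n \ K n)))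

/-- A global covering family (Definition 5.1). -/
def IsGCF (G : GradedPoset P) (F : ℕ → PosetFunctor P)
    (π : ∀ n : ℕ, PosetHom (kerPrime G (F n) n) (F (n + 1))) (K : ℕ → Set P) : Prop :=
  (∀ n : ℕ, K n ⊆ obSet G n) ∧
  (∀ n : ℕ, Function.Injective
    (fun (s : ↥(PosetFunctor.sections (F n))) => (fun p : ↥(K n) => s.1 p.1))) ∧
  (∀ n : ℕ, IsPureHom (wMap G F π K n))

/-- `Ob_n(P)` as a `Finset` (given that each degree level is finite). -/
noncomputable def obFinset (G : GradedPoset P)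
    (hfin : ∀ i : ℤ, {p : P | G.deg p = i}.Finite) (n : ℕ) : Finset P :=
  (hfin (n : ℤ)).toFinset

/-- `K_n` as a `Finset`. -/
noncomputable def KFinset (G : GradedPoset P)
    (hfin : ∀ i : ℤ, {p : P | G.deg p = i}.Finite) (K : ℕ → Set P) (n : ℕ) : Finset P :=
  ((hfin (n : ℤ)).inter_of_left (K n)).toFinset

/-- The Betti numbers `b_n^𝒦` of a global covering family (Definition 5.2). -/
noncomputable def bettiK (G : GradedPoset P)
    (hfin : ∀ i : ℤ, {p : P | G.deg p = i}.Finite) (K : ℕ → Set P) : ℕ → ℤ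
  | 0 => ∑ p ∈ KFinset G hfin K 0, Rnum G 0 p
  | n + 1 =>
      (∑ p ∈ KFinset G hfin K n, Rnum G n p) - (∑ p ∈ obFinset G hfin n, Rnum G n p) +
        ∑ p ∈ KFinset G hfin K (n + 1), Rnum G (n + 1) p

/-- The sequence of functors `F_0 = c_ℤ, F_1, F_2, …` of Proposition 4.3, together with
the connecting short exact sequences `0 → F_{n-1} → Ker'_{F_{n-1}} → F_n → 0` and all
their properties. -/
structure CondensedSequence (G : GradedPoset P) (J : P → ℕ → Set P) : Type 1 where
  F : ℕ → PosetFunctor P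
  pi : ∀ n : ℕ, PosetHom (kerPrime G (F n) n) (F (n + 1))
  F_zero : F 0 = constZ P
  pi_surj : ∀ (n : ℕ) (p : P), Function.Surjective ((pi n).app p)
  pi_ker : ∀ (n : ℕ) (p : P), ((pi n).app p).ker = ((lambdaNT G (F n) n).app p).range
  condensed : ∀ n : ℕ, IsCondensed G (F n) n
  free : ∀ n : ℕ, IsFreeFunctor (F n)
  determined : ∀ n : ℕ, IsDetermined G J (F n) n
  rank_eq : ∀ (n : ℕ) (p : P), (n : ℤ) ≤ G.deg p →
    (Module.finrank ℤ ((F n).obj p) : ℤ) = Rnum G n p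

/-! ### Simplex-like posets -/

/-- The poset `Δ_n` of faces of the standard `n`-dimensional simplex, ordered by
inclusion: faces are the nonempty subsets of the vertex set. -/
def SimplexPoset (n : ℕ) : Type := {s : Finset (Fin (n + 1)) // s.Nonempty}

instance (n : ℕ) : PartialOrder (SimplexPoset n) := Subtype.partialOrder _

/-- A poset `P` is simplex-like (with dimension function `d`) if for every `p` the
category `(P ↓ p)` is isomorphic to `Δ_{d p}`. -/
def SimplexLike (P : Type) [PartialOrder P] (d : P → ℕ) : Prop :=
  ∀ p : P, Nonempty ({q : P // q ≤ p} ≃o SimplexPoset (d p))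

/-- Elements killed by `λ` vanish, by induction on the size of the up-set. -/
theorem lambda_ker_aux {P : Type} [PartialOrder P] (G : GradedPoset P) (F : PosetFunctor P)
    (n : ℕ) (hF : IsCondensed G F n) (k : ℕ) :
    ∀ p : P, {q : P | p ≤ q}.ncard = k → ∀ x : F.obj p,
      (∀ (q : P) (h : p ≤ q), G.deg q = (n : ℤ) → F.map h x = 0) → x = 0 := by
  induction k using Nat.strong_induction_on with
  | _ k ih =>
    intro p hp x hx
    rcases lt_trichotomy (G.deg p) (n : ℤ) with h | h | h
    · exact hF.1 p h x
    · rw [← F.map_id p x]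
      exact hx p le_rfl h
    · refine hF.2 p h x ?_
      intro q hq
      refine ih _ ?_ q rfl _ ?_
      · rw [← hp]
        refine Set.ncard_lt_ncard ⟨fun r hr => hq.le.trans hr, fun hsub => ?_⟩ (G.finite_up p)
        exact absurd (hsub (show p ≤ p from le_rfl)) (not_le_of_gt hq)
      · intro r hr hd
        rw [F.map_comp]
        exact hx r _ hd

/-- The objectwise cokernel of a natural transformation. -/
def cokerFunctor {P : Type} [PartialOrder P] {A B : PosetFunctor P} (f : PosetHom A B) :
    PosetFunctor P where
  obj p := B.obj p ⧸ (f.app p).range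
  grp _ := inferInstance
  map {p q} h := QuotientAddGroup.map _ _ (B.map h) (by
    rintro _ ⟨x, rfl⟩
    exact ⟨A.map h x, (f.naturality h x).symm⟩)
  map_id p x := by
    induction x using QuotientAddGroup.induction_on with
    | H z => exact congrArg _ (B.map_id p z)
  map_comp h₁ h₂ x := by
    induction x using QuotientAddGroup.induction_on with
    | H z => exact congrArg _ (B.map_comp h₁ h₂ z)

/-- The projection to the cokernel. -/
def cokerProj {P : Type} [PartialOrder P] {A B : PosetFunctor P} (f : PosetHom A B) :
    PosetHom B (cokerFunctor f) where
  app p := QuotientAddGroup.mk' (f.app p).range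
  naturality _ _ := rfl

/-- **Lemma 2.9.** Let `F : 𝒫 → Ab` be an `n`-condensed functor on a graded poset `𝒫`.
Then the natural transformation `λ : F ⇒ Ker'_F` is a monomorphism (objectwise
injective), so there is a short exact sequence `0 → F → Ker'_F → G → 0` in `Ab^𝒫`,
where `G` takes the value `(∏_{p ∈ (p₀↓𝒫)_n} F(p)) / λ_{p₀}(F(p₀))` on each object `p₀`
(expressed by: `G` is an objectwise quotient of `Ker'_F` by the image of `λ`). -/
theorem lemma_2_9 {P : Type} [PartialOrder P] (G : GradedPoset P) (F : PosetFunctor P)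
    (n : ℕ) (hF : IsCondensed G F n) :
    (∀ p₀ : P, Function.Injective ((lambdaNT G F n).app p₀)) ∧
    ∃ (Gf : PosetFunctor P) (π : PosetHom (kerPrime G F n) Gf),
      (∀ p₀ : P, Function.Surjective (π.app p₀)) ∧
      ∀ p₀ : P, (π.app p₀).ker = ((lambdaNT G F n).app p₀).range := by
  refine ⟨fun p₀ => ?_, cokerFunctor (lambdaNT G F n), cokerProj (lambdaNT G F n),
    fun p₀ => QuotientAddGroup.mk'_surjective _, fun p₀ => QuotientAddGroup.ker_mk' _⟩
  rw [injective_iff_map_eq_zero]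
  intro x hx
  exact lambda_ker_aux G F n hF _ p₀ rfl x fun q h hd => congrFun hx ⟨q, h, hd⟩
end

section
/- Let 𝒫 be a graded poset and 𝒥 an adequate local covering family for 𝒫. Then there is a sequence of functors F_0, F_1, F_2, … in Ab^𝒫 with F_0 = c_ℤ (the constant functor ℤ), connected by short exact sequences 0 → F_{n−1} → Ker'_{F_{n−1}} → F_n → 0 for n ≥ 1, such that each F_n is n-condensed, free and 𝒥-determined, and rk F_n(p₀) = R_n^{p₀} for every object p₀ with deg(p₀) ≥ n. -/
open Finset

variable {P : Type} [PartialOrder P]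

/-! ### Auxiliary lemmas for the proof -/

section Aux

theorem aux_pi_mod {ι : Type} [Fintype ι] (A : ι → Type) [∀ i, AddCommGroup (A i)]
    (h : ∀ i, Module.Free ℤ (A i) ∧ Module.Finite ℤ (A i)) :
    Module.Free ℤ (∀ i, A i) ∧ Module.Finite ℤ (∀ i, A i) ∧
      Module.finrank ℤ (∀ i, A i) = ∑ i, Module.finrank ℤ (A i) := by
  have := fun i => (h i).1
  have := fun i => (h i).2
  exact ⟨inferInstance, inferInstance, Module.finrank_pi_fintype ℤ⟩

theorem aux_rank {A B C : Type} [AddCommGroup A] [AddCommGroup B] [AddCommGroup C]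
    [Module.Finite ℤ B] (f : A →+ B) (g : B →+ C) (hf : Function.Injective f)
    (hg : Function.Surjective g) (he : g.ker = f.range) :
    Module.finrank ℤ C + Module.finrank ℤ A = Module.finrank ℤ B := by
  have h1 := Submodule.finrank_quotient_add_finrank (LinearMap.range f.toIntLinearMap)
  have h2 : LinearMap.range f.toIntLinearMap = LinearMap.ker g.toIntLinearMap := by
    ext b
    have : b ∈ g.ker ↔ b ∈ f.range := by rw [he]
    rw [LinearMap.mem_range, LinearMap.mem_ker]
    exact this.symm
  have h3 := (LinearEquiv.ofInjective f.toIntLinearMap hf).finrank_eq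
  have h4 := ((Submodule.quotEquivOfEq _ _ h2).trans
    (g.toIntLinearMap.quotKerEquivOfSurjective hg)).finrank_eq
  rw [h3, ← h4]
  exact h1

theorem aux_free {A B C : Type} [AddCommGroup A] [AddCommGroup B] [AddCommGroup C]
    [Module.Finite ℤ B] (f : A →+ B) (g : B →+ C)
    (hg : Function.Surjective g) (he : g.ker = f.range)
    (ht : ∀ (k : ℤ) (b : B) (a : A), k ≠ 0 → f a = k • b → ∃ a', f a' = b) :
    Module.Free ℤ C ∧ Module.Finite ℤ C := by
  have : Module.Finite ℤ C := Module.Finite.of_surjective g.toIntLinearMap hg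
  have : Module.IsTorsionFree ℤ C := by
    apply Module.IsTorsionFree.of_smul_eq_zero
    intro r m hm
    by_cases hr : r = 0
    · exact Or.inl hr
    right
    obtain ⟨b, rfl⟩ := hg m
    have h1 : r • b ∈ g.ker := by
      rw [AddMonoidHom.mem_ker, map_zsmul]; exact hm
    rw [he] at h1
    obtain ⟨a, ha⟩ := h1
    obtain ⟨a', ha'⟩ := ht r b a hr ha
    have h2 : b ∈ g.ker := by rw [he]; exact ⟨a', ha'⟩
    exact h2
  exact ⟨inferInstance, inferInstance⟩

theorem aux_pure {A B : Type} [AddCommGroup A] [AddCommGroup B]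
    [Module.Finite ℤ B] (f : A →+ B)
    (ht : ∀ (k : ℤ) (b : B) (a : A), k ≠ 0 → f a = k • b → ∃ a', f a' = b) :
    IsPureHom f :=
  (aux_free f (QuotientAddGroup.mk' f.range) (QuotientAddGroup.mk'_surjective _)
    (QuotientAddGroup.ker_mk' _) ht).1

theorem aux_surj {A B : Type} [AddCommGroup A] [AddCommGroup B]
    [Module.Finite ℤ B] (f : A →+ B) (hf : Function.Injective f) (hp : IsPureHom f)
    (hr : Module.finrank ℤ A = Module.finrank ℤ B) : Function.Surjective f := by
  have hs := QuotientAddGroup.mk'_surjective f.range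
  have h := aux_rank f (QuotientAddGroup.mk' f.range) hf hs (QuotientAddGroup.ker_mk' _)
  have : Module.Free ℤ (B ⧸ f.range) := hp
  have : Module.Finite ℤ (B ⧸ f.range) :=
    Module.Finite.of_surjective (QuotientAddGroup.mk' f.range).toIntLinearMap hs
  have h0 : Module.finrank ℤ (B ⧸ f.range) = 0 := by omega
  have h1 : Subsingleton (B ⧸ f.range) := Module.finrank_zero_iff.1 h0
  intro b
  have h2 : QuotientAddGroup.mk' f.range b = 0 := Subsingleton.elim _ _
  rw [← AddMonoidHom.mem_ker, QuotientAddGroup.ker_mk'] at h2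
  exact h2

theorem aux_zsmul {A : Type} [AddCommGroup A] (h : Module.Free ℤ A) {k : ℤ} (hk : k ≠ 0)
    {a b : A} (hab : k • a = k • b) : a = b :=
  smul_right_injective A hk hab

theorem aux_cover (G : GradedPoset P) {p q : P} (h : p < q) :
    ∃ r, p < r ∧ r ≤ q ∧ G.deg p = G.deg r + 1 := by
  have hfin : {x : P | p < x ∧ x ≤ q}.Finite :=
    (G.finite_up p).subset fun x hx => hx.1.le
  obtain ⟨r, hr⟩ := hfin.exists_minimal ⟨q, h, le_rfl⟩
  refine ⟨r, hr.1.1, hr.1.2, G.deg_step hr.1.1 ?_⟩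
  intro s h1 h2
  rcases h1.eq_or_lt with h3 | h3
  · exact Or.inl h3.symm
  · exact Or.inr (le_antisymm h2 (hr.2 ⟨h3, h2.trans hr.1.2⟩ h2))

theorem aux_deg_lt (G : GradedPoset P) {p q : P} (h : p < q) : G.deg q < G.deg p := by
  obtain ⟨r, _, h2, h3⟩ := aux_cover G h
  have := G.deg_antitone h2
  omega

theorem aux_lt (G : GradedPoset P) {p q : P} (h : p ≤ q) (hd : G.deg q < G.deg p) : p < q := by
  rcases h.eq_or_lt with h | h
  · subst h; exact absurd hd (lt_irrefl _)
  · exact h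

/-- `λ` is monic for condensed functors. -/
theorem aux_lambda_inj (G : GradedPoset P) (F : PosetFunctor P) (n : ℕ)
    (hc : IsCondensed G F n) : ∀ (d : ℕ) (p : P), G.deg p = d → ∀ x : F.obj p,
      (∀ (q : P) (h : p ≤ q), G.deg q = (n : ℤ) → F.map h x = 0) → x = 0 := by
  intro d
  induction d using Nat.strong_induction_on with
  | _ d ih =>
    intro p hp x hx
    rcases lt_trichotomy (G.deg p) (n : ℤ) with h | h | h
    · exact hc.1 p h x
    · have := hx p le_rfl h
      rwa [F.map_id] at this
    · refine hc.2 p h x ?_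
      intro r hr
      have h1 := aux_deg_lt G hr
      have h2 := G.deg_nonneg r
      refine ih (G.deg r).toNat (by omega) r (by omega) _ ?_
      intro q hq hqd
      rw [F.map_comp]
      exact hx q _ hqd

theorem aux_lambda_inj' (G : GradedPoset P) (F : PosetFunctor P) (n : ℕ)
    (hc : IsCondensed G F n) (p : P) (x y : F.obj p)
    (h : ∀ (q : P) (h : p ≤ q), G.deg q = (n : ℤ) → F.map h x = F.map h y) : x = y := by
  have h0 := G.deg_nonneg p
  have := aux_lambda_inj G F n hc (G.deg p).toNat p (by omega) (x - y) (by
    intro q hq hd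
    rw [map_sub, h q hq hd, sub_self])
  exact sub_eq_zero.1 this

/-- The cokernel functor of `λ`. -/
def cokF (G : GradedPoset P) (F : PosetFunctor P) (n : ℕ) : PosetFunctor P where
  obj p := (kerPrime G F n).obj p ⧸ ((lambdaNT G F n).app p).range
  grp _ := inferInstance
  map {p q} h := QuotientAddGroup.map _ _ ((kerPrime G F n).map h) (by
    rintro _ ⟨x, rfl⟩
    exact ⟨F.map h x, ((lambdaNT G F n).naturality h x).symm⟩)
  map_id p x := by
    obtain ⟨x, rfl⟩ := QuotientAddGroup.mk_surjective x
    rfl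
  map_comp h₁ h₂ x := by
    obtain ⟨x, rfl⟩ := QuotientAddGroup.mk_surjective x
    rfl

/-- The projection `Ker'_F ⇒ coker λ`. -/
def cokPi (G : GradedPoset P) (F : PosetFunctor P) (n : ℕ) :
    PosetHom (kerPrime G F n) (cokF G F n) where
  app p := QuotientAddGroup.mk' ((lambdaNT G F n).app p).range
  naturality _ _ := rfl

theorem cokPi_surj (G : GradedPoset P) (F : PosetFunctor P) (n : ℕ) (p : P) :
    Function.Surjective ((cokPi G F n).app p) :=
  QuotientAddGroup.mk'_surjective _

theorem cokPi_ker (G : GradedPoset P) (F : PosetFunctor P) (n : ℕ) (p : P) :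
    ((cokPi G F n).app p).ker = ((lambdaNT G F n).app p).range :=
  QuotientAddGroup.ker_mk' _

theorem cokPi_zero (G : GradedPoset P) (F : PosetFunctor P) (n : ℕ) (p : P)
    (x : (kerPrime G F n).obj p) :
    (cokPi G F n).app p x = 0 ↔ ∃ y : F.obj p, ∀ q : degSet G p n, F.map q.2.1 y = x q := by
  rw [← AddMonoidHom.mem_ker, cokPi_ker]
  constructor
  · rintro ⟨y, rfl⟩
    exact ⟨y, fun q => rfl⟩
  · rintro ⟨y, hy⟩
    exact ⟨y, funext hy⟩

/-- All the properties carried by the induction. -/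
structure AuxGood (G : GradedPoset P) (J : P → ℕ → Set P) (F : PosetFunctor P) (n : ℕ) :
    Prop where
  condensed : IsCondensed G F n
  free : IsFreeFunctor F
  determined : IsDetermined G J F n
  rank_eq : ∀ p : P, (n : ℤ) ≤ G.deg p → (Module.finrank ℤ (F.obj p) : ℤ) = Rnum G n p

theorem aux_det_inj (G : GradedPoset P) (J : P → ℕ → Set P) (hJ : IsAdequate G J)
    (F : PosetFunctor P) (n : ℕ) (hF : AuxGood G J F n) (p : P) (hp : (n : ℤ) + 1 ≤ G.deg p) :
    Function.Injective (detMap F p (J p n)) := by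
  rcases hp.eq_or_lt with h | h
  · exact (hF.determined.2 p h.symm).2
  · rw [injective_iff_map_eq_zero]
    intro x hx
    refine hF.condensed.2 p (by omega) x ?_
    have hinj := (hF.determined.1 p h).1
    let s : ↥(sectionsOnSet F {q : P | p < q}) :=
      ⟨fun q => F.map (le_of_lt q.2) x, fun q r hqr => F.map_comp _ _ _⟩
    let t : ↥(sectionsOnSet F {q : P | p < q}) :=
      ⟨fun q => 0, fun q r hqr => map_zero _⟩
    have hst : s = t := by
      apply hinj
      funext q
      exact congrFun hx ⟨q.1, q.2.1, le_of_lt q.2.2⟩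
    intro q hq
    exact congrFun (congrArg Subtype.val hst) ⟨q, hq⟩

theorem aux_sum (G : GradedPoset P) (F : PosetFunctor P) (n : ℕ)
    (hf : IsFreeFunctor F)
    (hr : ∀ p : P, (n : ℤ) ≤ G.deg p → (Module.finrank ℤ (F.obj p) : ℤ) = Rnum G n p)
    (S : Finset P) (T : Set P) (hST : ∀ q, q ∈ S ↔ q ∈ T)
    (hd : ∀ q ∈ T, (n : ℤ) ≤ G.deg q) :
    Module.Free ℤ (∀ q : T, F.obj q.1) ∧ Module.Finite ℤ (∀ q : T, F.obj q.1) ∧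
    (Module.finrank ℤ (∀ q : T, F.obj q.1) : ℤ) = ∑ q ∈ S, Rnum G n q := by
  have : Fintype T := Fintype.subtype S hST
  obtain ⟨h1, h2, h3⟩ := aux_pi_mod (fun q : T => F.obj q.1) (fun q => hf q.1)
  refine ⟨h1, h2, ?_⟩
  rw [h3, Nat.cast_sum, Finset.sum_subtype S hST]
  exact Finset.sum_congr rfl fun q _ => hr q.1 (hd _ q.2)

theorem aux_J_mod (G : GradedPoset P) (J : P → ℕ → Set P) (hJ : IsAdequate G J)
    (F : PosetFunctor P) (n : ℕ) (hf : IsFreeFunctor F)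
    (hr : ∀ p : P, (n : ℤ) ≤ G.deg p → (Module.finrank ℤ (F.obj p) : ℤ) = Rnum G n p) (p : P) :
    Module.Free ℤ (∀ q : ↥(J p n ∩ {q : P | p ≤ q}), F.obj q.1) ∧
    Module.Finite ℤ (∀ q : ↥(J p n ∩ {q : P | p ≤ q}), F.obj q.1) ∧
    (Module.finrank ℤ (∀ q : ↥(J p n ∩ {q : P | p ≤ q}), F.obj q.1) : ℤ) =
      ∑ q ∈ JFinset G J p n, Rnum G n q := by
  apply aux_sum G F n hf hr
  · intro q
    simp [JFinset, and_comm]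
  · intro q hq
    exact (hJ.1.1 p n hq.1).2.ge

theorem aux_det_surj (G : GradedPoset P) (J : P → ℕ → Set P) (hJ : IsAdequate G J)
    (F : PosetFunctor P) (n : ℕ) (hF : AuxGood G J F n) (p : P) (hp : (n : ℤ) + 1 ≤ G.deg p) :
    Function.Surjective (detMap F p (J p n)) := by
  obtain ⟨h1, h2, h3⟩ := aux_J_mod G J hJ F n hF.free hF.rank_eq p
  refine aux_surj _ (aux_det_inj G J hJ F n hF p hp) ?_ ?_
  · rcases hp.eq_or_lt with h | h
    · exact (hF.determined.2 p h.symm).1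
    · exact (hF.determined.1 p h).2
  · have h4 := hF.rank_eq p (by omega)
    rw [hJ.2.2 n p hp, ← h3] at h4
    exact_mod_cast h4

theorem aux_det_zero (G : GradedPoset P) (J : P → ℕ → Set P) (hJ : IsAdequate G J)
    (F : PosetFunctor P) (n : ℕ) (hF : AuxGood G J F n) (p : P) (hp : (n : ℤ) + 1 ≤ G.deg p)
    (y : F.obj p) (hy : ∀ (q : P) (h : p ≤ q), q ∈ J p n → F.map h y = 0) : y = 0 := by
  apply aux_det_inj G J hJ F n hF p hp
  rw [map_zero]
  funext q
  exact hy q.1 q.2.2 q.2.1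

/-- Every class in the cokernel has a representative that vanishes on `J`. -/
theorem aux_rep (G : GradedPoset P) (J : P → ℕ → Set P) (hJ : IsAdequate G J)
    (F : PosetFunctor P) (n : ℕ) (hF : AuxGood G J F n) (p : P) (hp : (n : ℤ) + 1 ≤ G.deg p)
    (c : (cokF G F n).obj p) : ∃ x : ∀ q : degSet G p n, F.obj q.1,
      (cokPi G F n).app p x = c ∧ ∀ q : degSet G p n, q.1 ∈ J p n → x q = 0 := by
  obtain ⟨x, rfl⟩ := cokPi_surj G F n p c
  obtain ⟨y, hy⟩ := aux_det_surj G J hJ F n hF p hp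
    (fun q => x ⟨q.1, hJ.1.1 p n q.2.1⟩)
  refine ⟨x - (lambdaNT G F n).app p y, ?_, ?_⟩
  · have : (cokPi G F n).app p ((lambdaNT G F n).app p y) = 0 := by
      rw [cokPi_zero]
      exact ⟨y, fun q => rfl⟩
    rw [map_sub, this, sub_zero]
  · intro q hq
    have h1 : F.map q.2.1 y = x q := congrFun hy ⟨q.1, hq, q.2.1⟩
    exact sub_eq_zero.2 h1.symm

/-- A representative vanishing on `J` whose class is zero is zero. -/
theorem aux_rep_zero (G : GradedPoset P) (J : P → ℕ → Set P) (hJ : IsAdequate G J)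
    (F : PosetFunctor P) (n : ℕ) (hF : AuxGood G J F n) (p : P) (hp : (n : ℤ) + 1 ≤ G.deg p)
    (x : ∀ q : degSet G p n, F.obj q.1)
    (hx : ∀ q : degSet G p n, q.1 ∈ J p n → x q = 0)
    (h0 : (cokPi G F n).app p x = 0) : x = 0 := by
  obtain ⟨y, hy⟩ := (cokPi_zero G F n p x).1 h0
  have : y = 0 := by
    refine aux_det_zero G J hJ F n hF p hp y ?_
    intro q h hq
    exact (hy ⟨q, hJ.1.1 p n hq⟩).trans (hx _ hq)
  funext q
  rw [← hy q, this, map_zero]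
  rfl

theorem aux_low (G : GradedPoset P) (F : PosetFunctor P) (n : ℕ) (p : P)
    (hp : G.deg p < (n : ℤ) + 1) (c : (cokF G F n).obj p) : c = 0 := by
  obtain ⟨x, rfl⟩ := cokPi_surj G F n p c
  rw [cokPi_zero]
  by_cases h : G.deg p = n
  · refine ⟨F.map (le_refl p) (x ⟨p, le_rfl, h⟩), ?_⟩
    rintro ⟨q, hq, hd⟩
    rcases hq.eq_or_lt with h1 | h1
    · subst h1
      rw [F.map_comp]
      exact F.map_id _ _
    · have := aux_deg_lt G h1
      omega
  · refine ⟨0, ?_⟩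
    rintro ⟨q, hq, hd⟩
    have := G.deg_antitone hq
    omega

theorem aux_ker_mod (G : GradedPoset P) (F : PosetFunctor P) (n : ℕ) (hf : IsFreeFunctor F)
    (hr : ∀ p : P, (n : ℤ) ≤ G.deg p → (Module.finrank ℤ (F.obj p) : ℤ) = Rnum G n p) (p : P) :
    Module.Free ℤ ((kerPrime G F n).obj p) ∧ Module.Finite ℤ ((kerPrime G F n).obj p) ∧
    (Module.finrank ℤ ((kerPrime G F n).obj p) : ℤ) = ∑ q ∈ degFinset G p n, Rnum G n q := by
  refine aux_sum G F n hf hr (degFinset G p n) (degSet G p n) ?_ ?_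
  · intro q
    simp [degFinset]
  · intro q hq
    exact hq.2.ge

theorem aux_cok_free (G : GradedPoset P) (J : P → ℕ → Set P) (hJ : IsAdequate G J)
    (F : PosetFunctor P) (n : ℕ) (hF : AuxGood G J F n) : IsFreeFunctor (cokF G F n) := by
  intro p
  obtain ⟨h1, h2, h3⟩ := aux_ker_mod G F n hF.free hF.rank_eq p
  refine aux_free ((lambdaNT G F n).app p) ((cokPi G F n).app p) (cokPi_surj G F n p)
    (cokPi_ker G F n p) ?_
  intro k b a hk hab
  suffices h : (cokPi G F n).app p b = 0 by
    rw [← AddMonoidHom.mem_ker, cokPi_ker] at h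
    exact h
  by_cases hp : (n : ℤ) + 1 ≤ G.deg p
  · obtain ⟨x, hx1, hx2⟩ := aux_rep G J hJ F n hF p hp ((cokPi G F n).app p b)
    have h4 : (k • x : ∀ q : degSet G p n, F.obj q.1) = 0 := by
      refine aux_rep_zero G J hJ F n hF p hp _ ?_ ?_
      · intro q hq
        rw [Pi.smul_apply, hx2 q hq, smul_zero]
      · have h5 : (cokPi G F n).app p (k • b) = 0 := by
          rw [← AddMonoidHom.mem_ker, cokPi_ker]
          exact ⟨a, hab⟩
        rw [map_zsmul, ← hx1] at h5
        exact (map_zsmul ((cokPi G F n).app p) k x).trans h5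
    have h5 : x = 0 := by
      refine aux_zsmul (A := (kerPrime G F n).obj p) h1 hk ?_
      exact Eq.trans h4 (smul_zero (A := (kerPrime G F n).obj p) k).symm
    rw [← hx1, h5]
    exact map_zero ((cokPi G F n).app p)
  · exact aux_low G F n p (by omega) _

theorem aux_cok_rank (G : GradedPoset P) (J : P → ℕ → Set P) (hJ : IsAdequate G J)
    (F : PosetFunctor P) (n : ℕ) (hF : AuxGood G J F n) (p : P)
    (hp : ((n + 1 : ℕ) : ℤ) ≤ G.deg p) :
    (Module.finrank ℤ ((cokF G F n).obj p) : ℤ) = Rnum G (n + 1) p := by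
  obtain ⟨h1, h2, h3⟩ := aux_ker_mod G F n hF.free hF.rank_eq p
  have h4 := aux_rank ((lambdaNT G F n).app p) ((cokPi G F n).app p) (by
    intro x y hxy
    apply aux_lambda_inj' G F n hF.condensed
    intro q hq hd
    exact congrFun hxy ⟨q, hq, hd⟩) (cokPi_surj G F n p) (cokPi_ker G F n p)
  have h5 := hF.rank_eq p (by push_cast at hp; omega)
  rw [Rnum, ← h3, ← h4, ← h5]
  push_cast
  ring

theorem aux_cok_condensed (G : GradedPoset P) (J : P → ℕ → Set P) (hJ : IsAdequate G J)
    (F : PosetFunctor P) (n : ℕ) (hF : AuxGood G J F n) :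
    IsCondensed G (cokF G F n) (n + 1) := by
  refine ⟨fun p hp c => aux_low G F n p (by push_cast at hp; omega) c, ?_⟩
  intro p hp c hc
  push_cast at hp
  obtain ⟨x, rfl⟩ := cokPi_surj G F n p c
  have h1 : ∀ (r : P) (h : p < r), ∃ y : F.obj r, ∀ q : degSet G r n,
      F.map q.2.1 y = x ⟨q.1, h.le.trans q.2.1, q.2.2⟩ := by
    intro r h
    have h2 := hc r h
    rw [(cokPi G F n).naturality, cokPi_zero] at h2
    exact h2
  choose y hy using h1
  let s : ↥(sectionsOnSet F {q : P | p < q}) := ⟨fun q => y q.1 q.2, by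
    intro q r hqr
    apply aux_lambda_inj' G F n hF.condensed
    intro t ht hd
    rw [F.map_comp]
    exact (hy q.1 q.2 ⟨t, hqr.trans ht, hd⟩).trans (hy r.1 r.2 ⟨t, ht, hd⟩).symm⟩
  obtain ⟨z, hz⟩ := aux_det_surj G J hJ F n hF p (by omega)
    (fun q => y q.1 (aux_lt G q.2.2 (by
      have := (hJ.1.1 p n q.2.1).2
      omega)))
  let t : ↥(sectionsOnSet F {q : P | p < q}) :=
    ⟨fun q => F.map (le_of_lt q.2) z, fun q r hqr => F.map_comp _ _ _⟩
  have hst : t = s := by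
    apply (hF.determined.1 p (by omega)).1
    funext q
    exact congrFun hz ⟨q.1, q.2.1, le_of_lt q.2.2⟩
  rw [cokPi_zero]
  refine ⟨z, ?_⟩
  intro q
  have hlt : p < q.1 := aux_lt G q.2.1 (by have := q.2.2; omega)
  have h3 : F.map q.2.1 z = y q.1 hlt := congrFun (congrArg Subtype.val hst) ⟨q.1, hlt⟩
  have h4 := hy q.1 hlt ⟨q.1, le_rfl, q.2.2⟩
  rw [h3, ← F.map_id q.1 (y q.1 hlt)]
  exact h4

theorem aux_cok_inj (G : GradedPoset P) (J : P → ℕ → Set P) (hJ : IsAdequate G J)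
    (F : PosetFunctor P) (n : ℕ) (hF : AuxGood G J F n) (p : P) (hp : (n : ℤ) + 2 ≤ G.deg p)
    (c : (cokF G F n).obj p)
    (hc : ∀ (r : P) (h : p ≤ r), r ∈ J p (n + 1) → (cokF G F n).map h c = 0) : c = 0 := by
  obtain ⟨x, rfl, hx⟩ := aux_rep G J hJ F n hF p (by omega) c
  suffices h : x = 0 by rw [h]; exact map_zero ((cokPi G F n).app p)
  funext q
  have hq : q.1 ∈ ⋃ r ∈ J p (n + 1), degSet G r n := by
    rw [hJ.1.2.1 p n (by omega)]; exact q.2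
  simp only [Set.mem_iUnion] at hq
  obtain ⟨r, hr, hqr⟩ := hq
  have hrd := hJ.1.1 p (n + 1) hr
  have hrd2 := hrd.2
  push_cast at hrd2
  have h1 := ((cokPi G F n).naturality hrd.1 x).symm.trans (hc r hrd.1 hr)
  have h2 := aux_rep_zero G J hJ F n hF r (by omega) _ (by
    intro t ht
    exact hx ⟨t.1, hrd.1.trans t.2.1, t.2.2⟩ (hJ.1.2.2 p n r hr ht)) h1
  exact congrFun h2 ⟨q.1, hqr⟩

theorem aux_cok_pure (G : GradedPoset P) (J : P → ℕ → Set P) (hJ : IsAdequate G J)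
    (F : PosetFunctor P) (n : ℕ) (hF : AuxGood G J F n) (p : P) (hp : (n : ℤ) + 2 ≤ G.deg p) :
    IsPureHom (detMap (cokF G F n) p (J p (n + 1))) := by
  obtain ⟨_, h2, _⟩ := aux_J_mod G J hJ (cokF G F n) (n + 1) (aux_cok_free G J hJ F n hF)
    (aux_cok_rank G J hJ F n hF) p
  apply aux_pure
  intro k b a hk hab
  obtain ⟨x, rfl, hx⟩ := aux_rep G J hJ F n hF p (by omega) a
  have hdeg : ∀ r ∈ J p (n + 1), (n : ℤ) + 1 ≤ G.deg r := by
    intro r hr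
    have := (hJ.1.1 p (n + 1) hr).2
    push_cast at this
    omega
  have hz : ∀ r : ↥(J p (n + 1) ∩ {q : P | p ≤ q}),
      ∃ z : ∀ q : degSet G r.1 n, F.obj q.1,
      (cokPi G F n).app r.1 z = b r ∧ ∀ q : degSet G r.1 n, q.1 ∈ J r.1 n → z q = 0 :=
    fun r => aux_rep G J hJ F n hF r.1 (hdeg _ r.2.1) (b r)
  choose z hz1 hz2 using hz
  have key : ∀ (r : ↥(J p (n + 1) ∩ {q : P | p ≤ q})) (q : degSet G r.1 n),
      k • z r q = x ⟨q.1, r.2.2.trans q.2.1, q.2.2⟩ := by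
    intro r q
    have h0 : (cokF G F n).map r.2.2 ((cokPi G F n).app p x) = k • b r := congrFun hab r
    replace h0 := ((cokPi G F n).naturality r.2.2 x).symm.trans h0
    rw [← hz1 r] at h0
    have h3 := aux_rep_zero G J hJ F n hF r.1 (hdeg _ r.2.1)
      (fun q => k • z r q - x ⟨q.1, r.2.2.trans q.2.1, q.2.2⟩) (by
        intro t ht
        show k • z r t - x ⟨t.1, r.2.2.trans t.2.1, t.2.2⟩ = 0
        rw [hz2 r t ht, hx ⟨t.1, r.2.2.trans t.2.1, t.2.2⟩
          (hJ.1.2.2 p n r.1 r.2.1 ht), smul_zero, sub_zero]) (by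
        have h4 : (cokPi G F n).app r.1
            (k • (show (kerPrime G F n).obj r.1 from z r) - (kerPrime G F n).map r.2.2 x) = 0 := by
          rw [map_sub, map_zsmul, h0]
          exact sub_self _
        exact h4)
    exact sub_eq_zero.1 (congrFun h3 q)
  have hcov : ∀ q : degSet G p n, ∃ r : ↥(J p (n + 1) ∩ {q : P | p ≤ q}), q.1 ∈ degSet G r.1 n := by
    intro q
    have hq : q.1 ∈ ⋃ r ∈ J p (n + 1), degSet G r n := by
      rw [hJ.1.2.1 p n (by omega)]; exact q.2
    simp only [Set.mem_iUnion] at hq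
    obtain ⟨r, hr, hqr⟩ := hq
    exact ⟨⟨r, hr, (hJ.1.1 p (n + 1) hr).1⟩, hqr⟩
  choose ρ hρ using hcov
  let w : (kerPrime G F n).obj p := fun q => z (ρ q) ⟨q.1, hρ q⟩
  refine ⟨(cokPi G F n).app p w, ?_⟩
  funext r
  rw [← hz1 r]
  show (cokF G F n).map r.2.2 ((cokPi G F n).app p w) = _
  rw [(cokPi G F n).naturality]
  congr 1
  funext q
  refine aux_zsmul (hF.free q.1).1 hk ?_
  rw [key r q]
  exact key (ρ ⟨q.1, r.2.2.trans q.2.1, q.2.2⟩) ⟨q.1, hρ ⟨q.1, r.2.2.trans q.2.1, q.2.2⟩⟩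

theorem aux_cok_lim (G : GradedPoset P) (J : P → ℕ → Set P) (hJ : IsAdequate G J)
    (F : PosetFunctor P) (n : ℕ) (hF : AuxGood G J F n) (p : P) (hp : (n : ℤ) + 2 < G.deg p) :
    Function.Injective (limRestriction (cokF G F n) p (J p (n + 1))) := by
  intro s t hst
  have hcond := aux_cok_condensed G J hJ F n hF
  have h1 : ∀ (r : P) (hr : r ∈ J p (n + 2)) (hlt : p < r), s.1 ⟨r, hlt⟩ = t.1 ⟨r, hlt⟩ := by
    intro r hr hlt
    have hrd := (hJ.1.1 p (n + 2) hr).2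
    push_cast at hrd
    rw [← sub_eq_zero]
    refine aux_cok_inj G J hJ F n hF r (by omega) _ ?_
    intro q hq hqJ
    have hq' : p < q := lt_of_lt_of_le hlt hq
    rw [map_sub, s.2 ⟨r, hlt⟩ ⟨q, hq'⟩ hq, t.2 ⟨r, hlt⟩ ⟨q, hq'⟩ hq, sub_eq_zero]
    exact congrFun hst ⟨q, hJ.1.2.2 p (n + 1) r hr hqJ, hq'⟩
  apply Subtype.ext
  funext u
  apply aux_lambda_inj' G (cokF G F n) (n + 1) hcond
  intro q hq hd
  have hpq : p < q := lt_of_lt_of_le u.2 hq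
  have hqU : q ∈ ⋃ r ∈ J p (n + 1 + 1), degSet G r (n + 1) := by
    rw [hJ.1.2.1 p (n + 1) (by push_cast; omega)]; exact ⟨hpq.le, hd⟩
  simp only [Set.mem_iUnion] at hqU
  obtain ⟨r, hr, hqr⟩ := hqU
  have hrd := hJ.1.1 p (n + 2) hr
  have hlt : p < r := aux_lt G hrd.1 (by have := hrd.2; push_cast at this; omega)
  rw [s.2 u ⟨q, hpq⟩ hq, t.2 u ⟨q, hpq⟩ hq, ← s.2 ⟨r, hlt⟩ ⟨q, hpq⟩ hqr.1,
    ← t.2 ⟨r, hlt⟩ ⟨q, hpq⟩ hqr.1, h1 r hr hlt]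

theorem aux_step (G : GradedPoset P) (J : P → ℕ → Set P) (hJ : IsAdequate G J)
    (F : PosetFunctor P) (n : ℕ) (hF : AuxGood G J F n) :
    AuxGood G J (cokF G F n) (n + 1) where
  condensed := aux_cok_condensed G J hJ F n hF
  free := aux_cok_free G J hJ F n hF
  rank_eq := aux_cok_rank G J hJ F n hF
  determined := by
    refine ⟨fun p hp => ?_, fun p hp => ?_⟩
    · push_cast at hp
      exact ⟨aux_cok_lim G J hJ F n hF p (by omega), aux_cok_pure G J hJ F n hF p (by omega)⟩
    · push_cast at hp
      refine ⟨aux_cok_pure G J hJ F n hF p (by omega), ?_⟩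
      rw [injective_iff_map_eq_zero]
      intro c hc
      refine aux_cok_inj G J hJ F n hF p (by omega) c ?_
      intro r h hr
      exact congrFun hc ⟨r, hr, h⟩

theorem aux_base (G : GradedPoset P) (J : P → ℕ → Set P) (hJ : IsAdequate G J) :
    AuxGood G J (constZ P) 0 := by
  have hfree : IsFreeFunctor (constZ P) := fun p =>
    ⟨inferInstanceAs (Module.Free ℤ ℤ), inferInstanceAs (Module.Finite ℤ ℤ)⟩
  have hrank : ∀ p : P, ((0 : ℕ) : ℤ) ≤ G.deg p →
      (Module.finrank ℤ ((constZ P).obj p) : ℤ) = Rnum G 0 p := by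
    intro p _
    have : Module.finrank ℤ ((constZ P).obj p) = 1 := Module.finrank_self ℤ
    rw [this, Rnum]
    rfl
  have hJ1 : ∀ p : P, 1 ≤ G.deg p → ∃ j, p < j ∧ j ∈ J p 0 ∧ ∀ q ∈ J p 0, q = j := by
    intro p hp
    have h := hJ.2.2 0 p (by simpa using hp)
    simp only [Rnum, Finset.sum_const, nsmul_eq_mul, mul_one] at h
    have h' : (JFinset G J p 0).card = 1 := by exact_mod_cast h.symm
    obtain ⟨j, hj⟩ := Finset.card_eq_one.1 h'
    have hmem : ∀ q, q ∈ J p 0 ↔ q = j := by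
      intro q
      rw [← Finset.mem_singleton, ← hj]
      simp only [JFinset, Set.Finite.mem_toFinset]
      exact ⟨fun h => ⟨(hJ.1.1 p 0 h).1, h⟩, fun h => h.2⟩
    have hjJ := (hmem j).2 rfl
    have hjd := hJ.1.1 p 0 hjJ
    refine ⟨j, aux_lt G hjd.1 ?_, hjJ, fun q hq => (hmem q).1 hq⟩
    have := hjd.2
    push_cast at this
    omega
  have hpure : ∀ p : P, 1 ≤ G.deg p → IsPureHom (detMap (constZ P) p (J p 0)) := by
    intro p hp
    obtain ⟨j, hj1, hj2, hj3⟩ := hJ1 p hp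
    obtain ⟨_, h2, _⟩ := aux_J_mod G J hJ (constZ P) 0 hfree hrank p
    apply aux_pure
    intro k b a _ _
    refine ⟨b ⟨j, hj2, hj1.le⟩, ?_⟩
    funext q
    obtain ⟨q, hq⟩ := q
    obtain rfl := hj3 q hq.1
    rfl
  refine ⟨⟨?_, ?_⟩, hfree, ⟨?_, ?_⟩, hrank⟩
  · intro p hp
    have := G.deg_nonneg p
    push_cast at hp
    omega
  · intro p hp x hx
    obtain ⟨j, hj1, _⟩ := hJ1 p (by push_cast at hp; omega)
    exact hx j hj1
  · intro p hp
    push_cast at hp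
    refine ⟨?_, hpure p (by omega)⟩
    obtain ⟨j, hj1, hj2, hj3⟩ := hJ1 p (by omega)
    have hconst : ∀ (s : ↥(sectionsOnSet (constZ P) {q : P | p < q}))
        (a b : {q : P | p < q}), (show ℤ from s.1 a) = (show ℤ from s.1 b) := by
      intro s a b
      have := (hJ.2.1 p (by omega)).2 a b
      induction this with
      | refl => rfl
      | tail _ h ih =>
        rename_i u v _
        rcases h with h | h
        · exact ih.trans (s.2 u v h)
        · exact ih.trans (s.2 v u h).symm
    intro s t hst
    apply Subtype.ext
    funext u
    have h1 : s.1 ⟨j, hj1⟩ = t.1 ⟨j, hj1⟩ := congrFun hst ⟨j, hj2, hj1⟩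
    exact (hconst s u ⟨j, hj1⟩).trans (Eq.trans h1 (hconst t ⟨j, hj1⟩ u))
  · intro p hp
    push_cast at hp
    refine ⟨hpure p (by omega), ?_⟩
    obtain ⟨j, hj1, hj2, hj3⟩ := hJ1 p (by omega)
    intro x y hxy
    exact congrFun hxy ⟨j, hj2, hj1.le⟩

/-- The sequence of functors. -/
def auxSeq (G : GradedPoset P) : ℕ → PosetFunctor P
  | 0 => constZ P
  | n + 1 => cokF G (auxSeq G n) n

theorem auxSeq_good (G : GradedPoset P) (J : P → ℕ → Set P) (hJ : IsAdequate G J) :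
    ∀ n, AuxGood G J (auxSeq G n) n
  | 0 => aux_base G J hJ
  | n + 1 => aux_step G J hJ _ n (auxSeq_good G J hJ n)

end Aux

/-- **Proposition 4.3.** Let `𝒫` be a graded poset and `𝒥` an adequate local covering
family. Then there is a sequence of functors `F₀ = c_ℤ, F₁, F₂, …` connected by short
exact sequences `0 → F_{n-1} → Ker'_{F_{n-1}} → F_n → 0`, such that each `F_n` is
`n`-condensed, free and `𝒥`-determined, and `rk F_n(p₀) = R_n^{p₀}` for every object
`p₀` with `deg p₀ ≥ n`. -/
theorem prop_4_3 {P : Type} [PartialOrder P] (G : GradedPoset P) (J : P → ℕ → Set P)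
    (hJ : IsAdequate G J) :
    Nonempty (CondensedSequence G J) := by
  exact ⟨{
    F := auxSeq G
    pi := fun n => cokPi G (auxSeq G n) n
    F_zero := rfl
    pi_surj := fun n p => cokPi_surj G (auxSeq G n) n p
    pi_ker := fun n p => cokPi_ker G (auxSeq G n) n p
    condensed := fun n => (auxSeq_good G J hJ n).condensed
    free := fun n => (auxSeq_good G J hJ n).free
    determined := fun n => (auxSeq_good G J hJ n).determined
    rank_eq := fun n => (auxSeq_good G J hJ n).rank_eq }⟩
end

section
/- For each n ≥ 0 there exists an adequate local covering family 𝒥 for the graded poset Δ_n^op, obtained by fixing a total order v_0 < v_1 < … < v_n on the vertices and letting J_m^σ consist of the m-dimensional faces of σ containing the greatest vertex of σ; moreover, for every face σ of Δ_n and 0 ≤ m ≤ deg(σ) one has R_m^σ = Σ_{l=0}^m (−1)^{m−l} · C(deg(σ)+1, l), where C denotes the binomial coefficient. -/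
open Finset

variable {P : Type} [PartialOrder P]

/-- The greatest vertex of a face `σ` of the standard simplex (with respect to the fixed
total order `v_0 < v_1 < … < v_n` on the vertices). -/
def maxVert {n : ℕ} (σ : SimplexPoset n) : Fin (n + 1) := σ.1.max' σ.2

/-- The local covering family for `Δ_n^op`: `J_m^σ` consists of the `m`-dimensional
faces of `σ` which contain the greatest vertex of `σ`. -/
def simplexJ (n : ℕ) : (SimplexPoset n)ᵒᵈ → ℕ → Set ((SimplexPoset n)ᵒᵈ) :=
  fun σ m =>
    {τ | (OrderDual.ofDual τ).1 ⊆ (OrderDual.ofDual σ).1 ∧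
      (OrderDual.ofDual τ).1.card = m + 1 ∧
      maxVert (OrderDual.ofDual σ) ∈ (OrderDual.ofDual τ).1}

section Helpers

lemma alt_sum_choose (k m : ℕ) :
    ∑ l ∈ Finset.range (m + 1), (-1 : ℤ) ^ (m - l) * ((k + 1).choose l : ℤ) = (k.choose m : ℤ) := by
  induction m with
  | zero => simp
  | succ m ih =>
    rw [Finset.sum_range_succ]
    have : ∑ l ∈ Finset.range (m + 1), (-1 : ℤ) ^ (m + 1 - l) * ((k + 1).choose l : ℤ)
        = - ∑ l ∈ Finset.range (m + 1), (-1 : ℤ) ^ (m - l) * ((k + 1).choose l : ℤ) := by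
      rw [← Finset.sum_neg_distrib]
      refine Finset.sum_congr rfl fun l hl => ?_
      have hl' : l ≤ m := by simpa [Nat.lt_succ_iff] using hl
      rw [Nat.succ_sub hl', pow_succ]
      ring
    rw [this, ih, Nat.choose_succ_succ]
    simp

lemma card_degF (n : ℕ) (G : GradedPoset ((SimplexPoset n)ᵒᵈ))
    (hdeg : ∀ σ : (SimplexPoset n)ᵒᵈ, G.deg σ = ((OrderDual.ofDual σ).1.card : ℤ) - 1)
    (σ : (SimplexPoset n)ᵒᵈ) (m : ℕ) :
    (degFinset G σ m).card = (OrderDual.ofDual σ).1.card.choose (m + 1) := by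
  rw [← Finset.card_powersetCard]
  refine Finset.card_bij (fun τ _ => (OrderDual.ofDual τ).1) ?_ ?_ ?_
  · intro τ hτ
    simp only [degFinset, Set.Finite.mem_toFinset, degSet, Set.mem_ofPred_eq, hdeg] at hτ
    rw [Finset.mem_powersetCard]
    exact ⟨hτ.1, by omega⟩
  · intro a _ b _ h
    exact Subtype.ext h
  · intro s hs
    rw [Finset.mem_powersetCard] at hs
    have hne : s.Nonempty := Finset.card_pos.mp (by omega)
    refine ⟨OrderDual.toDual ⟨s, hne⟩, ?_, rfl⟩
    simp only [degFinset, Set.Finite.mem_toFinset, degSet, Set.mem_ofPred_eq, hdeg]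
    refine ⟨hs.1, ?_⟩
    change ((s.card : ℕ) : ℤ) - 1 = m
    rw [hs.2]; push_cast; ring

lemma card_J (n : ℕ) (G : GradedPoset ((SimplexPoset n)ᵒᵈ))
    (σ : (SimplexPoset n)ᵒᵈ) (m : ℕ) :
    (JFinset G (simplexJ n) σ m).card = ((OrderDual.ofDual σ).1.card - 1).choose m := by
  have hmem : maxVert (OrderDual.ofDual σ) ∈ (OrderDual.ofDual σ).1 := Finset.max'_mem _ _
  rw [← Finset.card_erase_of_mem hmem, ← Finset.card_powersetCard]
  refine Finset.card_bij
    (fun τ _ => (OrderDual.ofDual τ).1.erase (maxVert (OrderDual.ofDual σ))) ?_ ?_ ?_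
  · intro τ hτ
    simp only [JFinset, Set.Finite.mem_toFinset, simplexJ, Set.mem_inter_iff,
      Set.mem_ofPred_eq] at hτ
    rw [Finset.mem_powersetCard]
    refine ⟨Finset.erase_subset_erase _ hτ.2.1, ?_⟩
    rw [Finset.card_erase_of_mem hτ.2.2.2, hτ.2.2.1]; rfl
  · intro a ha b hb h
    simp only [JFinset, Set.Finite.mem_toFinset, simplexJ, Set.mem_inter_iff,
      Set.mem_ofPred_eq] at ha hb
    have h2 := congrArg (insert (maxVert (OrderDual.ofDual σ))) h
    simp only [Finset.insert_erase ha.2.2.2, Finset.insert_erase hb.2.2.2] at h2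
    exact Subtype.ext h2
  · intro s hs
    rw [Finset.mem_powersetCard] at hs
    have hv : maxVert (OrderDual.ofDual σ) ∉ s := fun h => by simpa using hs.1 h
    have hsub : insert (maxVert (OrderDual.ofDual σ)) s ⊆ (OrderDual.ofDual σ).1 :=
      Finset.insert_subset hmem (hs.1.trans (Finset.erase_subset _ _))
    refine ⟨OrderDual.toDual ⟨insert (maxVert (OrderDual.ofDual σ)) s,
      Finset.insert_nonempty _ _⟩, ?_, ?_⟩
    · simp only [JFinset, Set.Finite.mem_toFinset, simplexJ, Set.mem_inter_iff,
        Set.mem_ofPred_eq]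
      refine ⟨hsub, hsub, ?_, Finset.mem_insert_self _ _⟩
      exact (Finset.card_insert_of_notMem hv).trans (by rw [hs.2])
    · exact Finset.erase_insert hv

lemma card_pos_face {n : ℕ} (σ : (SimplexPoset n)ᵒᵈ) : 0 < (OrderDual.ofDual σ).1.card :=
  Finset.card_pos.mpr (OrderDual.ofDual σ).2

lemma Rnum_eq (n : ℕ) (G : GradedPoset ((SimplexPoset n)ᵒᵈ))
    (hdeg : ∀ σ : (SimplexPoset n)ᵒᵈ, G.deg σ = ((OrderDual.ofDual σ).1.card : ℤ) - 1)
    (m : ℕ) : ∀ σ : (SimplexPoset n)ᵒᵈ,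
    Rnum G m σ = (((OrderDual.ofDual σ).1.card - 1).choose m : ℤ) := by
  induction m with
  | zero => intro σ; simp [Rnum]
  | succ m ih =>
    intro σ
    have h1 : ∑ q ∈ degFinset G σ m, Rnum G m q = ∑ q ∈ degFinset G σ m, 1 := by
      refine Finset.sum_congr rfl fun τ hτ => ?_
      simp only [degFinset, Set.Finite.mem_toFinset, degSet, Set.mem_ofPred_eq, hdeg] at hτ
      have : (OrderDual.ofDual τ).1.card - 1 = m := by omega
      rw [ih, this]; simp
    rw [Rnum, h1, ih, Finset.sum_const, card_degF n G hdeg]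
    obtain ⟨k, hk⟩ := Nat.exists_eq_succ_of_ne_zero (card_pos_face σ).ne'
    rw [hk, Nat.succ_eq_add_one, Nat.choose_succ_succ]
    simp

lemma simplex_LCF (n : ℕ) (G : GradedPoset ((SimplexPoset n)ᵒᵈ))
    (hdeg : ∀ σ : (SimplexPoset n)ᵒᵈ, G.deg σ = ((OrderDual.ofDual σ).1.card : ℤ) - 1) :
    IsLCF G (simplexJ n) := by
  refine ⟨?_, ?_, ?_⟩
  · rintro σ m τ ⟨h1, h2, h3⟩
    refine ⟨h1, ?_⟩
    rw [hdeg, h2]; push_cast; ring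
  · intro σ m hm
    rw [hdeg] at hm
    apply Set.Subset.antisymm
    · intro τ hτ
      simp only [Set.mem_iUnion] at hτ
      obtain ⟨r, hr, h1, h2⟩ := hτ
      exact ⟨le_trans (show σ ≤ r from hr.1) h1, h2⟩
    · rintro τ ⟨h1, h2⟩
      rw [hdeg] at h2
      have h1' : (OrderDual.ofDual τ).1 ⊆ (OrderDual.ofDual σ).1 := h1
      have hmem : maxVert (OrderDual.ofDual σ) ∈ (OrderDual.ofDual σ).1 := Finset.max'_mem _ _
      have key : ∃ x ∈ (OrderDual.ofDual σ).1, x ∉ (OrderDual.ofDual τ).1 ∧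
          maxVert (OrderDual.ofDual σ) ∈ insert x (OrderDual.ofDual τ).1 := by
        by_cases hv : maxVert (OrderDual.ofDual σ) ∈ (OrderDual.ofDual τ).1
        · obtain ⟨x, hx, hx'⟩ := Finset.exists_mem_notMem_of_card_lt_card
            (show (OrderDual.ofDual τ).1.card < (OrderDual.ofDual σ).1.card by omega)
          exact ⟨x, hx, hx', Finset.mem_insert_of_mem hv⟩
        · exact ⟨_, hmem, hv, Finset.mem_insert_self _ _⟩
      obtain ⟨x, hx, hx', hv⟩ := key
      simp only [Set.mem_iUnion]
      refine ⟨OrderDual.toDual ⟨insert x (OrderDual.ofDual τ).1, Finset.insert_nonempty _ _⟩,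
        ⟨Finset.insert_subset hx h1', ?_, hv⟩, ?_, ?_⟩
      · exact (Finset.card_insert_of_notMem hx').trans (by omega)
      · exact Finset.subset_insert x (OrderDual.ofDual τ).1
      · rw [hdeg]; omega
  · rintro σ m r ⟨h1, _, h3⟩ τ ⟨t1, t2, t3⟩
    have : maxVert (OrderDual.ofDual r) = maxVert (OrderDual.ofDual σ) :=
      le_antisymm (Finset.max'_subset _ h1) (Finset.le_max' _ _ h3)
    exact ⟨t1.trans h1, t2, this ▸ t3⟩

lemma simplex_conn (n : ℕ) (σ : (SimplexPoset n)ᵒᵈ) (h : 3 ≤ (OrderDual.ofDual σ).1.card) :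
    IsConnectedSet {q : (SimplexPoset n)ᵒᵈ | σ < q} := by
  have mk : ∀ (s : Finset (Fin (n + 1))) (hs : s.Nonempty), s ⊆ (OrderDual.ofDual σ).1 →
      s.card ≤ 2 → σ < OrderDual.toDual (⟨s, hs⟩ : SimplexPoset n) := by
    intro s hs hsub hc
    refine lt_of_le_of_ne hsub ?_
    rintro rfl
    have : 3 ≤ s.card := h
    omega
  constructor
  · obtain ⟨x, hx⟩ := (OrderDual.ofDual σ).2
    exact ⟨_, mk {x} (Finset.singleton_nonempty x) (Finset.singleton_subset_iff.mpr hx)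
      (by simp)⟩
  · rintro ⟨a, ha⟩ ⟨b, hb⟩
    obtain ⟨x, hx⟩ := (OrderDual.ofDual a).2
    obtain ⟨y, hy⟩ := (OrderDual.ofDual b).2
    have ha' : (OrderDual.ofDual a).1 ⊆ (OrderDual.ofDual σ).1 := le_of_lt ha
    have hb' : (OrderDual.ofDual b).1 ⊆ (OrderDual.ofDual σ).1 := le_of_lt hb
    have hX := mk {x} (Finset.singleton_nonempty x) (Finset.singleton_subset_iff.mpr (ha' hx))
      (by simp)
    have hY := mk {y} (Finset.singleton_nonempty y) (Finset.singleton_subset_iff.mpr (hb' hy))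
      (by simp)
    have hXY := mk {x, y} (Finset.insert_nonempty _ _)
      (Finset.insert_subset (ha' hx) (Finset.singleton_subset_iff.mpr (hb' hy)))
      Finset.card_le_two
    refine Relation.ReflTransGen.head (b := ⟨_, hX⟩) (Or.inl ?_) <|
      Relation.ReflTransGen.head (b := ⟨_, hXY⟩) (Or.inr ?_) <|
      Relation.ReflTransGen.head (b := ⟨_, hY⟩) (Or.inl ?_) <|
      Relation.ReflTransGen.single (Or.inr ?_)
    · exact Finset.singleton_subset_iff.mpr hx
    · exact (Finset.singleton_subset_iff.mpr (by simp) : ({x} : Finset (Fin (n+1))) ⊆ {x, y})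
    · exact (Finset.singleton_subset_iff.mpr (by simp) : ({y} : Finset (Fin (n+1))) ⊆ {x, y})
    · exact Finset.singleton_subset_iff.mpr hy

end Helpers

/-- **Lemma 6.4.** For each `n ≥ 0` the family `𝒥` above is an adequate local covering
family for the graded poset `Δ_n^op` (whose degree function is the dimension,
`deg σ = |σ| − 1`); moreover, for every face `σ` of `Δ_n` and `0 ≤ m ≤ deg σ` one has
`R_m^σ = Σ_{l=0}^m (−1)^{m−l} · C(deg σ + 1, l)`. -/
theorem lemma_6_4 (n : ℕ) (G : GradedPoset ((SimplexPoset n)ᵒᵈ))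
    (hdeg : ∀ σ : (SimplexPoset n)ᵒᵈ, G.deg σ = ((OrderDual.ofDual σ).1.card : ℤ) - 1) :
    IsAdequate G (simplexJ n) ∧
    ∀ (σ : (SimplexPoset n)ᵒᵈ) (m : ℕ), (m : ℤ) ≤ G.deg σ →
      Rnum G m σ = ∑ l ∈ Finset.range (m + 1),
        (-1 : ℤ) ^ (m - l) * ((OrderDual.ofDual σ).1.card.choose l : ℤ) := by
  refine ⟨⟨simplex_LCF n G hdeg, ?_, ?_⟩, ?_⟩
  · intro p hp
    rw [hdeg] at hp
    exact simplex_conn n p (by omega)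
  · intro m p _
    have h1 : ∑ q ∈ JFinset G (simplexJ n) p m, Rnum G m q
        = ∑ q ∈ JFinset G (simplexJ n) p m, 1 := by
      refine Finset.sum_congr rfl fun τ hτ => ?_
      simp only [JFinset, Set.Finite.mem_toFinset, simplexJ, Set.mem_inter_iff,
        Set.mem_ofPred_eq] at hτ
      rw [Rnum_eq n G hdeg, hτ.2.2.1]; simp
    rw [h1, Rnum_eq n G hdeg, Finset.sum_const, card_J]
    simp
  · intro σ m _
    obtain ⟨k, hk⟩ := Nat.exists_eq_succ_of_ne_zero (card_pos_face σ).ne'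
    rw [Rnum_eq n G hdeg, hk, Nat.succ_eq_add_one, alt_sum_choose]
    simp
end
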